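/- Let σ_X > 0, R, R_c ∈ [0,∞], and P ∈ [0,∞). Then min over σ̂ ∈ [σ(P), σ_X] of [ σ_X² + σ̂² − 2 σ_X σ̂ √((1 − e^{−2R})(1 − e^{−2(R + R_c + P − ψ(σ̂))})) ] ≥ min over σ̂ ∈ [max{σ_X − √(2σ_X²(1 − e^{−P})), 0}, σ_X] of [ σ_X² + σ̂² − 2 σ_X √((1 − e^{−2R})(σ̂² − (max{σ_X e^{−(R+R_c)} − √(2σ_X²(1 − e^{−P})), 0})²)) ]. (That is, the explicit lower bound D̲(R,R_c,P|φ_KL) is at least the explicit lower bound D̲(R,R_c,2σ_X²(1−e^{−P})|W₂²).) -/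

import Mathlib

open MeasureTheory ProbabilityTheory Real Set
open scoped ENNReal NNReal

noncomputable section

open Classical in
/-- Kullback-Leibler divergence of `q` from `p`, in `[0,∞]`. -/
def KLD {α : Type*} [MeasurableSpace α] (q p : Measure α) : ℝ≥0∞ :=
  if q ≪ p ∧ Integrable (fun x => Real.log (q.rnDeriv p x).toReal) q
  then ENNReal.ofReal (∫ x, Real.log (q.rnDeriv p x).toReal ∂q) else ⊤

/-- Mutual information between `f` and `g` under `μ`. -/
def mutInfo {Ω α β : Type*} [MeasurableSpace Ω] [MeasurableSpace α] [MeasurableSpace β]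
    (μ : Measure Ω) (f : Ω → α) (g : Ω → β) : ℝ≥0∞ :=
  KLD (μ.map (fun ω => (f ω, g ω))) ((μ.map f).prod (μ.map g))

/-- Squared Wasserstein-2 distance. -/
def W2sq (p q : Measure ℝ) : ℝ≥0∞ :=
  ⨅ (cpl : Measure (ℝ × ℝ)) (_ : IsProbabilityMeasure cpl) (_ : cpl.map Prod.fst = p)
    (_ : cpl.map Prod.snd = q), ∫⁻ xy, ENNReal.ofReal ((xy.1 - xy.2) ^ 2) ∂cpl

/-- `exp(-x)` for `x ∈ [0,∞]`, with `exp(-∞) = 0`. -/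
def expNeg (x : ℝ≥0∞) : ℝ := if x = ⊤ then 0 else Real.exp (-x.toReal)

/-- Feasibility predicate for the distortion-rate-perception function. -/
def DRPfeasible (pX : Measure ℝ) (φ : Measure ℝ → Measure ℝ → ℝ≥0∞) (R Rc P : ℝ≥0∞)
    (μ : Measure (ℝ × ℝ × ℝ)) : Prop :=
  ∃ hμ : IsProbabilityMeasure μ,
    μ.map (fun w => w.1) = pX ∧
    (haveI := hμ
     CondIndepFun (MeasurableSpace.comap (fun w : ℝ × ℝ × ℝ => w.2.1) inferInstance)
      ((measurable_fst.comp measurable_snd).comap_le)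
      (fun w : ℝ × ℝ × ℝ => w.1) (fun w : ℝ × ℝ × ℝ => w.2.2) μ) ∧
    mutInfo μ (fun w => w.1) (fun w => w.2.1) ≤ R ∧
    mutInfo μ (fun w => w.2.2) (fun w => w.2.1) ≤ R + Rc ∧
    φ pX (μ.map (fun w => w.2.2)) ≤ P

/-- Mean squared distortion of a joint law of `(X, U, X̂)`. -/
def distortion (μ : Measure (ℝ × ℝ × ℝ)) : ℝ≥0∞ :=
  ∫⁻ w, ENNReal.ofReal ((w.1 - w.2.2) ^ 2) ∂μ

/-- The distortion-rate-perception function `D(R, R_c, P | φ)`. -/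
def DRP (pX : Measure ℝ) (φ : Measure ℝ → Measure ℝ → ℝ≥0∞) (R Rc P : ℝ≥0∞) : ℝ≥0∞ :=
  ⨅ (μ : Measure (ℝ × ℝ × ℝ)) (_ : DRPfeasible pX φ R Rc P μ), distortion μ

/-- `D(R, R_c, ∞)`: the DRP function without perception constraint. -/
def DRPinf (pX : Measure ℝ) (R Rc : ℝ≥0∞) : ℝ≥0∞ :=
  DRP pX (fun _ _ => 0) R Rc ⊤

/-- Deterministic-decoder (entropy-constrained quantization) function `D_e(R, R_c)`,
with `H(X̂) := I(X̂; X̂)`. -/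
def De (pX : Measure ℝ) (R Rc : ℝ≥0∞) : ℝ≥0∞ :=
  ⨅ (cpl : Measure (ℝ × ℝ)) (_ : IsProbabilityMeasure cpl ∧ cpl.map Prod.fst = pX ∧
      mutInfo cpl Prod.fst Prod.snd ≤ R ∧ mutInfo cpl Prod.snd Prod.snd ≤ R + Rc),
    ∫⁻ w, ENNReal.ofReal ((w.1 - w.2) ^ 2) ∂cpl

/-- The Gaussian measure `N(μ, σ²)`. -/
def gauss (μ σ : ℝ) : Measure ℝ := gaussianReal μ ⟨σ ^ 2, sq_nonneg σ⟩

end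
noncomputable section

/-- `ξ(R, R_c) = √((1 - e^{-2R})(1 - e^{-2(R+R_c)}))`. -/
def xiRRc (R Rc : ℝ≥0∞) : ℝ :=
  Real.sqrt ((1 - expNeg (2 * R)) * (1 - expNeg (2 * (R + Rc))))

/-- `ψ(σ) = log(σ_X/σ) + (σ² - σ_X²)/(2σ_X²)`. -/
def psi (σX s : ℝ) : ℝ := Real.log (σX / s) + (s ^ 2 - σX ^ 2) / (2 * σX ^ 2)

/-- `δ₊(σ̂, α)` from the improved lower bound. -/
def deltaPlus (σX : ℝ) (R Rc : ℝ≥0∞) (P s α : ℝ) : ℝ :=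
  max (σX * expNeg (R + Rc) -
    Real.sqrt (σX ^ 2 - α * (σX ^ 2 + s ^ 2 - P) + α ^ 2 * s ^ 2)) 0 / α

/-- The inner `sup` over `α > 0` in the improved lower bound `D̲'`. -/
def DlowerPrimeFun (σX : ℝ) (R Rc : ℝ≥0∞) (P s : ℝ) : ℝ :=
  sSup ((fun α => σX ^ 2 + s ^ 2 - 2 * σX *
    Real.sqrt ((1 - expNeg (2 * R)) * (s ^ 2 - deltaPlus σX R Rc P s α ^ 2))) '' Set.Ioi 0)

/-- The improved explicit lower bound `D̲'(R, R_c, P | W₂²)`. -/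
def DlowerPrime (σX : ℝ) (R Rc : ℝ≥0∞) (P : ℝ) : ℝ :=
  sInf (DlowerPrimeFun σX R Rc P '' Set.Icc (max (σX - Real.sqrt P) 0) σX)

/-- The explicit lower bound `D̲(R, R_c, P | W₂²)` of Xie et al. -/
def DlowerW2 (σX : ℝ) (R Rc : ℝ≥0∞) (P : ℝ) : ℝ :=
  sInf ((fun s => σX ^ 2 + s ^ 2 - 2 * σX *
      Real.sqrt ((1 - expNeg (2 * R)) *
        (s ^ 2 - max (σX * expNeg (R + Rc) - Real.sqrt P) 0 ^ 2)))
    '' Set.Icc (max (σX - Real.sqrt P) 0) σX)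

end

lemma aux_exp (x : ℝ) (h0 : 0 ≤ x) (h1 : x ≤ 1) : (1 - x) * Real.exp x ≤ 1 - x ^ 2 / 2 := by
  have h := Real.exp_bound' h0 h1 (n := 3) (by norm_num)
  simp [Finset.sum_range_succ, Nat.factorial] at h
  have h2 := mul_le_mul_of_nonneg_left h (by linarith : 0 ≤ 1 - x)
  refine h2.trans ?_
  have h3 : 0 ≤ x ^ 3 := by positivity
  have h4 : 0 ≤ x ^ 4 := by positivity
  nlinarith

/-- Core scalar inequality. -/
lemma aux_core (E r : ℝ) (hE0 : 0 < E) (hE1 : E ≤ 1) (hr0 : 0 < r) (hr1 : r ≤ 1)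
    (h : E * Real.exp (-((1 - r ^ 2) / 2)) ≤ r) :
    1 - E * Real.exp (-((1 - r ^ 2) / 2)) ≤ Real.sqrt (2 * (1 - E)) := by
  obtain ⟨v, hv⟩ : ∃ v, v = (1 - r ^ 2) / 2 := ⟨_, rfl⟩
  rw [← hv] at h ⊢
  have hv0 : 0 ≤ v := by nlinarith
  have hv1 : v ≤ 1 / 2 := by nlinarith
  have hr2 : r ^ 2 = 1 - 2 * v := by linarith
  have key := aux_exp (2 * v) (by linarith) (by linarith)
  have hee : Real.exp (-v) ^ 2 * Real.exp (2 * v) = 1 := by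
    rw [← Real.exp_nat_mul, ← Real.exp_add]; simp
  have hsq : E ^ 2 * Real.exp (-v) ^ 2 ≤ 1 - 2 * v := by
    rw [← hr2, ← mul_pow]
    exact pow_le_pow_left₀ (by positivity) h 2
  have hE2 : E ^ 2 ≤ 1 - (2 * v) ^ 2 / 2 := by
    have := mul_le_mul_of_nonneg_right hsq (Real.exp_pos (2 * v)).le
    rw [mul_assoc, hee] at this
    linarith
  have hlow : 1 - v ≤ Real.exp (-v) := by
    have := Real.add_one_le_exp (-v); linarith
  have hlhs : 1 - E * Real.exp (-v) ≤ 1 - E * (1 - v) := by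
    have := mul_le_mul_of_nonneg_left hlow hE0.le
    linarith
  refine hlhs.trans (Real.le_sqrt_of_sq_le ?_)
  obtain ⟨u, hu⟩ : ∃ u, u = 1 - E := ⟨_, rfl⟩
  have hEu : E = 1 - u := by linarith
  subst hEu
  have hu0 : 0 ≤ u := by linarith
  have hv2 : v ^ 2 ≤ u - u ^ 2 / 2 := by nlinarith
  have a1 : u * (1 - u) * (2 * v) ≤ u * (1 - u) * 1 :=
    mul_le_mul_of_nonneg_left (by linarith) (mul_nonneg hu0 hE0.le)
  have a2 : (1 - u) ^ 2 * v ^ 2 ≤ 1 * v ^ 2 :=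
    mul_le_mul_of_nonneg_right (by nlinarith) (sq_nonneg v)
  nlinarith [sq_nonneg u]

lemma expNeg_nonneg' (x : ℝ≥0∞) : 0 ≤ expNeg x := by
  unfold expNeg; split_ifs <;> positivity

lemma expNeg_le_one' (x : ℝ≥0∞) : expNeg x ≤ 1 := by
  unfold expNeg
  split_ifs
  · norm_num
  · rw [Real.exp_le_one_iff]; simp

lemma expNeg_two (x : ℝ≥0∞) : expNeg (2 * x) = expNeg x ^ 2 := by
  unfold expNeg
  by_cases h : x = ⊤
  · simp [h]
  · have : 2 * x ≠ ⊤ := ENNReal.mul_ne_top (by simp) h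
    rw [if_neg this, if_neg h, ← Real.exp_nat_mul]
    simp

lemma psi_eq (σX s : ℝ) (hσ : 0 < σX) (hs : 0 < s) :
    psi σX s = -Real.log (s / σX) - (1 - (s / σX) ^ 2) / 2 := by
  unfold psi
  rw [← Real.log_inv, inv_div]
  field_simp
  ring

lemma psi_anti (σX a s : ℝ) (hσ : 0 < σX) (ha : 0 < a) (has : a ≤ s) (hs : s ≤ σX) :
    psi σX s ≤ psi σX a := by
  have hs0 : 0 < s := ha.trans_le has
  unfold psi
  rw [Real.log_div hσ.ne' hs0.ne', Real.log_div hσ.ne' ha.ne']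
  have h1 := Real.log_le_sub_one_of_pos (div_pos ha hs0)
  rw [Real.log_div ha.ne' hs0.ne'] at h1
  have h2 : (s ^ 2 - a ^ 2) / (2 * σX ^ 2) ≤ 1 - a / s := by
    rw [div_le_iff₀ (by positivity)]
    have : (1 - a / s) * (2 * σX ^ 2) = (s - a) * (2 * σX ^ 2) / s := by field_simp
    rw [this, le_div_iff₀ hs0]
    have h3 : (s + a) * s ≤ 2 * σX ^ 2 := by nlinarith
    nlinarith [mul_le_mul_of_nonneg_left h3 (sub_nonneg.2 has)]
  have h4 : (s ^ 2 - σX ^ 2) / (2 * σX ^ 2) - (a ^ 2 - σX ^ 2) / (2 * σX ^ 2)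
      = (s ^ 2 - a ^ 2) / (2 * σX ^ 2) := by ring
  linarith

/-- The explicit KL lower bound dominates the induced squared-Wasserstein-2 lower bound. -/
theorem stmt6 (σX : ℝ) (hσX : 0 < σX) (R Rc : ℝ≥0∞) (P : ℝ) (hP : 0 ≤ P)
    (sP : ℝ) (hsP : sP ∈ Set.Icc 0 σX) (hψ : psi σX sP = P) :
    sInf ((fun s => σX ^ 2 + s ^ 2 - 2 * σX * s *
        Real.sqrt ((1 - expNeg (2 * R)) *
          (1 - expNeg (2 * (R + Rc)) * Real.exp (-(2 : ℝ) * (P - psi σX s)))))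
      '' Set.Icc sP σX) ≥
    DlowerW2 σX R Rc (2 * σX ^ 2 * (1 - Real.exp (-P))) := by
  have hsP0 : 0 < sP := by
    rcases hsP.1.eq_or_lt with h | h
    · exfalso
      rw [← h] at hψ
      unfold psi at hψ
      have : (0 ^ 2 - σX ^ 2) / (2 * σX ^ 2) = -(1 / 2) := by field_simp; ring
      rw [this] at hψ
      simp at hψ
      linarith
    · exact h
  refine le_csInf ((Set.nonempty_Icc.2 hsP.2).image _) ?_
  rintro _ ⟨s, ⟨hs1, hs2⟩, rfl⟩
  have hs0 : 0 < s := hsP0.trans_le hs1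
  have hψs : psi σX s ≤ P := hψ ▸ psi_anti σX sP s hσX hsP0 hs1 hs2
  have hr0 : 0 < s / σX := by positivity
  have hr1 : s / σX ≤ 1 := (div_le_one hσX).2 hs2
  have hpe := psi_eq σX s hσX hs0
  obtain ⟨r, hr⟩ : ∃ r, r = s / σX := ⟨_, rfl⟩
  rw [← hr] at hr0 hr1 hpe
  have hsr : s = σX * r := by rw [hr]; field_simp
  obtain ⟨w, hw⟩ : ∃ w, w = Real.exp (-P) * Real.exp (-((1 - r ^ 2) / 2)) := ⟨_, rfl⟩
  have hw0 : 0 < w := by rw [hw]; positivity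
  have hwr : w ≤ r := by
    rw [hw, ← Real.exp_add, ← Real.le_log_iff_exp_le hr0]
    linarith
  have hcore : 1 - w ≤ Real.sqrt (2 * (1 - Real.exp (-P))) := by
    rw [hw]
    exact aux_core _ _ (Real.exp_pos _) (Real.exp_le_one_iff.2 (by linarith)) hr0 hr1 (hw ▸ hwr)
  have hsqrt : Real.sqrt (2 * σX ^ 2 * (1 - Real.exp (-P)))
      = σX * Real.sqrt (2 * (1 - Real.exp (-P))) := by
    rw [show 2 * σX ^ 2 * (1 - Real.exp (-P)) = σX ^ 2 * (2 * (1 - Real.exp (-P))) by ring,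
      Real.sqrt_mul (sq_nonneg _), Real.sqrt_sq hσX.le]
  have hexp : r * Real.exp (-(P - psi σX s)) = w := by
    rw [hw, hpe, ← Real.exp_add]
    nth_rewrite 1 [← Real.exp_log hr0]
    rw [← Real.exp_add]
    congr 1; ring
  unfold DlowerW2
  rw [hsqrt]
  obtain ⟨q, hq⟩ : ∃ q, q = Real.sqrt (2 * (1 - Real.exp (-P))) := ⟨_, rfl⟩
  rw [← hq] at hcore ⊢
  have hq0 : 0 ≤ q := hq ▸ Real.sqrt_nonneg _
  refine (csInf_le (IsCompact.bddBelow_image isCompact_Icc (by fun_prop))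
    (Set.mem_image_of_mem _ (?_ : s ∈ _))).trans ?_
  · refine ⟨max_le ?_ hs0.le, hs2⟩
    rw [hsr]
    nlinarith
  · have hc0 := expNeg_nonneg' (R + Rc)
    have hc1 := expNeg_le_one' (R + Rc)
    have ha : 0 ≤ 1 - expNeg (2 * R) := by linarith [expNeg_le_one' (2 * R)]
    rw [expNeg_two (R + Rc)]
    generalize expNeg (R + Rc) = c at *
    have hm : max (σX * c - σX * q) 0 ≤ σX * (c * w) := by
      refine max_le ?_ (by positivity)
      rw [← mul_sub]
      refine mul_le_mul_of_nonneg_left ?_ hσX.le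
      nlinarith
    have hm2 : max (σX * c - σX * q) 0 ^ 2 ≤ (σX * (c * w)) ^ 2 :=
      pow_le_pow_left₀ (le_max_right _ _) hm 2
    have hE : Real.exp (-2 * (P - psi σX s)) = Real.exp (-(P - psi σX s)) ^ 2 := by
      rw [← Real.exp_nat_mul]; congr 1; push_cast; ring
    have hprod : (σX * (c * w)) ^ 2 = s ^ 2 * (c ^ 2 * Real.exp (-2 * (P - psi σX s))) := by
      rw [hE, ← hexp]
      generalize Real.exp (-(P - psi σX s)) = y
      rw [hsr]
      ring
    have hS : s * Real.sqrt ((1 - expNeg (2 * R)) *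
          (1 - c ^ 2 * Real.exp (-2 * (P - psi σX s)))) ≤
        Real.sqrt ((1 - expNeg (2 * R)) * (s ^ 2 - max (σX * c - σX * q) 0 ^ 2)) := by
      nth_rewrite 1 [← Real.sqrt_sq hs0.le]
      rw [← Real.sqrt_mul (sq_nonneg s)]
      apply Real.sqrt_le_sqrt
      have := mul_le_mul_of_nonneg_left (hm2.trans_eq hprod) ha
      linarith
    have := mul_le_mul_of_nonneg_left hS (by positivity : 0 ≤ 2 * σX)
    dsimp only
    linarith
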